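/- arXiv:2305.04792 — 3 statements merged into one kernel-verified Lean document; each statement's English description precedes it below -/
import Mathlib

section
/- Let W be an n×n real doubly stochastic matrix, let η > 0 and μ ∈ ℝ, and let (X^t), (G^t), (B^t) be sequences of d×n real matrices satisfying, for every t ≥ 1, the GUT bias-correction recursion X^t = X^{t−1} W − η (G^{t−1} + μ B^{t−1}) together with B^t = −(1/η)[(X^t − X^{t−1})(2W − I) + η G^{t−1}]. Define the averaged bias b̄^t := B^t · (1/n) 𝟙𝟙ᵀ. Then for every t ≥ 1, b̄^t = μ b̄^{t−1}. -/
/-- The averaging matrix `(1/n) 𝟙𝟙ᵀ`, all of whose entries equal `1/n`. -/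
noncomputable def avgMat (n : ℕ) : Matrix (Fin n) (Fin n) ℝ := Matrix.of fun _ _ => (n : ℝ)⁻¹

/-- A matrix with unit row sums fixes the averaging matrix under left multiplication. -/
theorem mul_avgMat_of_row_sum {n : ℕ} {W : Matrix (Fin n) (Fin n) ℝ}
    (hW : ∀ i, ∑ j, W i j = 1) : W * avgMat n = avgMat n := by
  ext i j
  simp [avgMat, Matrix.mul_apply, ← Finset.sum_mul, hW]

/-- **Lemma 1 (GUT bias recursion).** If `W` is doubly stochastic and the sequences satisfy the
GUT bias-correction recursion `X^{t+1} = X^t W − η (G^t + μ B^t)` and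
`B^{t+1} = −(1/η)[(X^{t+1} − X^t)(2W − I) + η G^t]`, then the averaged bias
`b̄^t := B^t · (1/n) 𝟙𝟙ᵀ` satisfies `b̄^{t+1} = μ b̄^t` for every `t`. -/
theorem gut_average_bias_recursion
    {d n : ℕ} (W : Matrix (Fin n) (Fin n) ℝ)
    (hWnonneg : ∀ i j, 0 ≤ W i j)
    (hWrow : ∀ i, ∑ j, W i j = 1)
    (hWcol : ∀ j, ∑ i, W i j = 1)
    (η : ℝ) (hη : 0 < η) (μ : ℝ)
    (X G B : ℕ → Matrix (Fin d) (Fin n) ℝ)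
    (hX : ∀ t : ℕ, X (t + 1) = X t * W - η • (G t + μ • B t))
    (hB : ∀ t : ℕ,
      B (t + 1) = -(1 / η) • ((X (t + 1) - X t) * ((2 : ℝ) • W - 1) + η • G t)) :
    ∀ t : ℕ, B (t + 1) * avgMat n = μ • (B t * avgMat n) := by
  intro t
  have h2 : ((2 : ℝ) • W - 1) * avgMat n = avgMat n := by
    rw [Matrix.sub_mul, Matrix.smul_mul, mul_avgMat_of_row_sum hWrow, Matrix.one_mul, two_smul,
      add_sub_cancel_right]
  have hdiff : (X (t + 1) - X t) * avgMat n = -(η • ((G t + μ • B t) * avgMat n)) := by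
    rw [hX, Matrix.sub_mul, Matrix.sub_mul, Matrix.mul_assoc, mul_avgMat_of_row_sum hWrow,
      Matrix.smul_mul]
    abel
  rw [hB, Matrix.smul_mul, Matrix.add_mul, Matrix.mul_assoc, h2, hdiff, Matrix.smul_mul,
    ← smul_neg, ← smul_add, smul_smul, Matrix.add_mul, Matrix.smul_mul]
  have hc : -(1 / η) * η = -1 := by field_simp
  rw [hc, neg_one_smul]
  abel
end

section
/- Let W be an n×n real doubly stochastic matrix, let η > 0 and μ ∈ ℝ, and let (X^t), (G^t), (B^t) be sequences of d×n real matrices satisfying, for every t ≥ 0, X^{t+1} = X^t W − η (G^t + μ B^t) and, for every t ≥ 1, B^t = −(1/η)[(X^t − X^{t−1})(2W − I) + η G^{t−1}]. If B^0 · (1/n) 𝟙𝟙ᵀ = 0, then for every t ≥ 0 one has B^t · (1/n) 𝟙𝟙ᵀ = 0 and the column-average satisfies X̄^{t+1} = X̄^t − η Ḡ^t, where X̄ := X · (1/n) 𝟙𝟙ᵀ and Ḡ := G · (1/n) 𝟙𝟙ᵀ. In particular, the GUT algorithm preserves the average of the decentralized system (the injected bias averages to zero at every iteration). -/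
/-- A matrix whose rows sum to `1` fixes the averaging matrix under left multiplication. -/
theorem mul_avgMat_of_row_sum_eq_one {n : ℕ} {W : Matrix (Fin n) (Fin n) ℝ}
    (hWrow : ∀ i, ∑ j, W i j = 1) : W * avgMat n = avgMat n := by
  ext i k
  simp [avgMat, Matrix.mul_apply, ← Finset.sum_mul, hWrow]

/-- **Average preservation of GUT.** If `W` is doubly stochastic, the GUT bias-correction
recursion holds, and the initial averaged bias vanishes (`B^0 · (1/n)𝟙𝟙ᵀ = 0`), then the
averaged bias vanishes at every iteration and the column-average of the iterates evolves as
`X̄^{t+1} = X̄^t − η Ḡ^t`. -/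
theorem gut_preserves_average
    {d n : ℕ} (W : Matrix (Fin n) (Fin n) ℝ)
    (hWnonneg : ∀ i j, 0 ≤ W i j)
    (hWrow : ∀ i, ∑ j, W i j = 1)
    (hWcol : ∀ j, ∑ i, W i j = 1)
    (η : ℝ) (hη : 0 < η) (μ : ℝ)
    (X G B : ℕ → Matrix (Fin d) (Fin n) ℝ)
    (hX : ∀ t : ℕ, X (t + 1) = X t * W - η • (G t + μ • B t))
    (hB : ∀ t : ℕ,
      B (t + 1) = -(1 / η) • ((X (t + 1) - X t) * ((2 : ℝ) • W - 1) + η • G t))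
    (hB0 : B 0 * avgMat n = 0) :
    (∀ t : ℕ, B t * avgMat n = 0) ∧
      (∀ t : ℕ, X (t + 1) * avgMat n = X t * avgMat n - η • (G t * avgMat n)) := by
  have hWJ := mul_avgMat_of_row_sum_eq_one hWrow
  have step : ∀ t, B t * avgMat n = 0 →
      X (t + 1) * avgMat n = X t * avgMat n - η • (G t * avgMat n) := by
    intro t ht
    rw [hX, Matrix.sub_mul, Matrix.mul_assoc, hWJ, Matrix.smul_mul, Matrix.add_mul,
      Matrix.smul_mul, ht, smul_zero, add_zero]
  have bias : ∀ t, B t * avgMat n = 0 := by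
    intro t
    induction t with
    | zero => exact hB0
    | succ t ih =>
      have hJ : ((2 : ℝ) • W - 1) * avgMat n = avgMat n := by
        rw [Matrix.sub_mul, Matrix.smul_mul, hWJ, Matrix.one_mul, two_smul, add_sub_cancel_right]
      rw [hB, Matrix.smul_mul, Matrix.add_mul, Matrix.mul_assoc, hJ, Matrix.sub_mul, step t ih,
        Matrix.smul_mul, sub_sub_cancel_left, neg_add_cancel, smul_zero]
  exact ⟨bias, fun t => step t (bias t)⟩
end

section
/- Let W be any n×n real matrix, let η > 0 and μ ∈ ℝ, and let (X^t), (Y^t), (G^t) be sequences of d×n real matrices satisfying, for every t ≥ 0, the GUT tracking recursion X^{t+1} = X^t − η Y^t and, for every t ≥ 1, Y^t = Δ^t + μ[ Y^{t−1} W − (1/η) X^t (W − I) − Δ^{t−1} ], where Δ^t := G^t − (1/η) X^t (W − I). Then for every t ≥ 1, Y^t = G^t − (1/η) X^t (W − I) + μ B^t with B^t := −(1/η)[(X^t − X^{t−1})(2W − I) + η G^{t−1}], and consequently X^{t+1} = X^t W − η (G^t + μ B^t). That is, the tracking form of the GUT update is algebraically equivalent to its bias-correction form. -/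
/-- **Equivalence of the tracking and bias-correction forms of GUT.** For any `n×n` real matrix
`W`, if `X^{t+1} = X^t − η Y^t` and, for `t ≥ 1`,
`Y^t = Δ^t + μ[Y^{t−1} W − (1/η) X^t (W − I) − Δ^{t−1}]` with
`Δ^t = G^t − (1/η) X^t (W − I)`, then for every `t ≥ 1` one has
`Y^t = G^t − (1/η) X^t (W − I) + μ B^t` with
`B^t = −(1/η)[(X^t − X^{t−1})(2W − I) + η G^{t−1}]`, and consequently
`X^{t+1} = X^t W − η (G^t + μ B^t)`. -/
theorem gut_tracking_eq_bias_correction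
    {d n : ℕ} (W : Matrix (Fin n) (Fin n) ℝ)
    (η : ℝ) (hη : 0 < η) (μ : ℝ)
    (X Y G Δ : ℕ → Matrix (Fin d) (Fin n) ℝ)
    (hΔ : ∀ t : ℕ, Δ t = G t - (1 / η) • (X t * (W - 1)))
    (hX : ∀ t : ℕ, X (t + 1) = X t - η • Y t)
    (hY : ∀ t : ℕ,
      Y (t + 1) = Δ (t + 1) + μ • (Y t * W - (1 / η) • (X (t + 1) * (W - 1)) - Δ t)) :
    ∀ t : ℕ,
      Y (t + 1) = G (t + 1) - (1 / η) • (X (t + 1) * (W - 1)) +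
          μ • (-(1 / η) • ((X (t + 1) - X t) * ((2 : ℝ) • W - 1) + η • G t)) ∧
      X (t + 2) = X (t + 1) * W -
          η • (G (t + 1) +
            μ • (-(1 / η) • ((X (t + 1) - X t) * ((2 : ℝ) • W - 1) + η • G t))) := by
  intro t
  have hη' : η ≠ 0 := hη.ne'
  have hXt : X (t + 1) - X t = -(η • Y t) := by rw [hX t]; abel
  have hB : Y t * W - (1 / η) • (X (t + 1) * (W - 1)) - Δ t =
      -(1 / η) • ((X (t + 1) - X t) * ((2 : ℝ) • W - 1) + η • G t) := by
    rw [hΔ t, hXt, hX t]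
    simp only [Matrix.mul_sub, Matrix.sub_mul, Matrix.neg_mul, Matrix.mul_smul,
      Matrix.smul_mul, Matrix.mul_one]
    match_scalars <;> field_simp <;> ring
  have hYt : Y (t + 1) = G (t + 1) - (1 / η) • (X (t + 1) * (W - 1)) +
      μ • (-(1 / η) • ((X (t + 1) - X t) * ((2 : ℝ) • W - 1) + η • G t)) := by
    rw [hY t, hB, hΔ (t + 1)]
  refine ⟨hYt, ?_⟩
  rw [hX (t + 1), hYt]
  generalize -(1 / η) • ((X (t + 1) - X t) * ((2 : ℝ) • W - 1) + η • G t) = B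
  rw [Matrix.mul_sub, Matrix.mul_one]
  match_scalars <;> field_simp <;> ring
end
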